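/- (Proposition 1 of the paper, pointwise/linear form.) Let n ≥ 2, let r ≥ 1 be odd, and let φ : V ≃ V be a linear equivalence of n-dimensional Minkowski vector space. The following are equivalent: (i) φ is a causal relation (φ x ∈ Θ⁺ for all x ∈ Θ⁺); (ii) for every s ≥ 1 and every s-multilinear map T ∈ DP⁺_s, the pullback (u₁,...,u_s) ↦ T(φ u₁, ..., φ u_s) lies in DP⁺_s; (iii) for every r-multilinear map T ∈ DP⁺_r, the pullback (u₁,...,u_r) ↦ T(φ u₁, ..., φ u_r) lies in DP⁺_r. -/

import Mathlib

namespace PaperCausal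

variable {n : ℕ}

/-- The Lorentzian (Minkowski) bilinear form on `Fin n → ℝ`:
`η x y = x 0 * y 0 - ∑_{i ≠ 0} x i * y i`. -/
noncomputable def eta [NeZero n] (x y : Fin n → ℝ) : ℝ :=
  x 0 * y 0 - ∑ i ∈ Finset.univ.filter (fun i => i ≠ (0 : Fin n)), x i * y i

/-- `x ∈ Θ⁺`: future-directed causal vector. -/
def FutureCausal [NeZero n] (x : Fin n → ℝ) : Prop :=
  0 ≤ eta x x ∧ 0 < x 0

/-- Future-directed null vector. -/
def FutureNull [NeZero n] (x : Fin n → ℝ) : Prop :=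
  eta x x = 0 ∧ 0 < x 0

/-- Future-directed timelike vector. -/
def FutureTimelike [NeZero n] (x : Fin n → ℝ) : Prop :=
  0 < eta x x ∧ 0 < x 0

/-- The dominant property `T ∈ DP⁺_r` for an `r`-multilinear map. -/
def DPplus [NeZero n] {r : ℕ} (T : MultilinearMap ℝ (fun _ : Fin r => (Fin n → ℝ)) ℝ) : Prop :=
  ∀ v : Fin r → (Fin n → ℝ), (∀ i, FutureCausal (v i)) → 0 ≤ T v

/-- The dominant property `T ∈ DP⁺_2` for a bilinear form. -/
def DP2 [NeZero n] (T : (Fin n → ℝ) →ₗ[ℝ] (Fin n → ℝ) →ₗ[ℝ] ℝ) : Prop :=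
  ∀ u v : Fin n → ℝ, FutureCausal u → FutureCausal v → 0 ≤ T u v

/-- The linear functional `eta y`. -/
noncomputable def etaLin [NeZero n] (y : Fin n → ℝ) : (Fin n → ℝ) →ₗ[ℝ] ℝ where
  toFun := eta y
  map_add' a b := by
    simp only [eta, Pi.add_apply, mul_add, Finset.sum_add_distrib]
    ring
  map_smul' c a := by
    simp only [eta, Pi.smul_apply, smul_eq_mul, mul_left_comm _ c, ← Finset.mul_sum, mul_sub,
      RingHom.id_apply]

lemma eta_nonneg_of_futureCausal [NeZero n] {x y : Fin n → ℝ} (hx : FutureCausal x)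
    (hy : FutureCausal y) : 0 ≤ eta x y := by
  obtain ⟨hx, hx0⟩ := hx
  obtain ⟨hy, hy0⟩ := hy
  have hcs := Finset.sum_mul_sq_le_sq_mul_sq
    (Finset.univ.filter (fun i => i ≠ (0 : Fin n))) x y
  simp only [eta, ← pow_two, sub_nonneg] at hx hy ⊢
  refine le_of_sq_le_sq ?_ (by positivity)
  calc _ ≤ _ := hcs
    _ ≤ x 0 ^ 2 * y 0 ^ 2 :=
      mul_le_mul hx hy (Finset.sum_nonneg fun i _ => sq_nonneg _) (sq_nonneg _)
    _ = (x 0 * y 0) ^ 2 := by ring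

/-- The closed future causal cone is self-dual: a nonzero vector pairing nonnegatively with every
future-directed causal vector is itself future-directed causal. -/
lemma futureCausal_of_forall_eta_nonneg [NeZero n] {z : Fin n → ℝ} (hz : z ≠ 0)
    (h : ∀ y, FutureCausal y → 0 ≤ eta y z) : FutureCausal z := by
  set s := Finset.univ.filter (fun i => i ≠ (0 : Fin n)) with hs
  set q := ∑ i ∈ s, z i * z i with hq
  have hq0 : 0 ≤ q := Finset.sum_nonneg fun i _ => mul_self_nonneg _
  have eta_update (a : ℝ) (w v : Fin n → ℝ) :
      eta (Function.update w 0 a) v = a * v 0 - ∑ i ∈ s, w i * v i := by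
    rw [eta, Function.update_self]
    congr 1
    refine Finset.sum_congr rfl fun i hi => ?_
    rw [Function.update_of_ne (by simpa [hs] using hi)]
  have eta_update_self (a : ℝ) (w : Fin n → ℝ) :
      eta (Function.update w 0 a) (Function.update w 0 a) = a * a - ∑ i ∈ s, w i * w i := by
    rw [eta, Function.update_self]
    congr 1
    refine Finset.sum_congr rfl fun i hi => ?_
    rw [Function.update_of_ne (by simpa [hs] using hi)]
  rcases hq0.eq_or_lt with hq0 | hq0
  · have hzi : ∀ i ∈ s, z i = 0 := fun i hi => mul_self_eq_zero.1
      ((Finset.sum_eq_zero_iff_of_nonneg fun i _ => mul_self_nonneg (z i)).1 hq0.symm i hi)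
    have hz0 : z 0 ≠ 0 := fun h0 => hz <| funext fun i => by
      by_cases hi : i = 0
      · rw [hi, h0, Pi.zero_apply]
      · exact hzi i (by simp [hs, hi])
    have hpos : 0 ≤ eta (Function.update 0 0 1) z :=
      h _ ⟨by rw [eta_update_self]; simp, by simp⟩
    rw [eta_update] at hpos
    simp only [one_mul, Pi.zero_apply, zero_mul, Finset.sum_const_zero, sub_zero] at hpos
    refine ⟨?_, lt_of_le_of_ne hpos hz0.symm⟩
    change 0 ≤ z 0 * z 0 - q
    nlinarith
  · have hsqrt := Real.sqrt_pos.2 hq0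
    have hmul := Real.mul_self_sqrt hq0.le
    have hpos : 0 ≤ eta (Function.update z 0 √q) z :=
      h _ ⟨by rw [eta_update_self, hmul, sub_self], by simpa using hsqrt⟩
    rw [eta_update] at hpos
    have hle : √q ≤ z 0 := le_of_mul_le_mul_left (by linarith) hsqrt
    refine ⟨?_, hsqrt.trans_le hle⟩
    change 0 ≤ z 0 * z 0 - q
    nlinarith

/-- If pulling back along `φ` preserves the dominant property of `r`-multilinear maps for some
odd `r`, then `φ` is a causal relation. -/
lemma futureCausal_map_of_dpplus_compLinearMap [NeZero n] {r : ℕ} (hodd : Odd r)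
    (φ : (Fin n → ℝ) ≃ₗ[ℝ] (Fin n → ℝ))
    (h : ∀ T : MultilinearMap ℝ (fun _ : Fin r => (Fin n → ℝ)) ℝ,
      DPplus T → DPplus (T.compLinearMap (fun _ => φ.toLinearMap)))
    {x : Fin n → ℝ} (hx : FutureCausal x) : FutureCausal (φ x) := by
  have hx0 : x ≠ 0 := fun h0 => hx.2.ne' (by simp [h0])
  refine futureCausal_of_forall_eta_nonneg (φ.map_ne_zero_iff.2 hx0) fun y hy => ?_
  have hprod : DPplus ((MultilinearMap.mkPiAlgebra ℝ (Fin r) ℝ).compLinearMap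
      fun _ => etaLin y) := fun v hv => by
    rw [MultilinearMap.compLinearMap_apply, MultilinearMap.mkPiAlgebra_apply]
    exact Finset.prod_nonneg fun i _ => eta_nonneg_of_futureCausal hy (hv i)
  have hpow := h _ hprod (fun _ => x) fun _ => hx
  simp only [MultilinearMap.compLinearMap_apply, MultilinearMap.mkPiAlgebra_apply,
    Finset.prod_const, Finset.card_univ, Fintype.card_fin] at hpow
  exact hodd.pow_nonneg_iff.1 hpow

/-- Pullback along a causal relation preserves the dominant property. -/
lemma DPplus.compLinearMap [NeZero n] {s : ℕ} {φ : (Fin n → ℝ) ≃ₗ[ℝ] (Fin n → ℝ)}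
    (hφ : ∀ x : Fin n → ℝ, FutureCausal x → FutureCausal (φ x))
    {T : MultilinearMap ℝ (fun _ : Fin s => (Fin n → ℝ)) ℝ} (hT : DPplus T) :
    DPplus (T.compLinearMap (fun _ => φ.toLinearMap)) :=
  fun _ hv => hT _ fun i => hφ _ (hv i)

theorem proposition1 (n r : ℕ) [NeZero n] (hn : 2 ≤ n) (hr : 1 ≤ r) (hodd : Odd r)
    (φ : (Fin n → ℝ) ≃ₗ[ℝ] (Fin n → ℝ)) :
    ((∀ x : Fin n → ℝ, FutureCausal x → FutureCausal (φ x)) ↔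
      (∀ s : ℕ, 1 ≤ s → ∀ T : MultilinearMap ℝ (fun _ : Fin s => (Fin n → ℝ)) ℝ,
        DPplus T → DPplus (T.compLinearMap (fun _ => φ.toLinearMap)))) ∧
    ((∀ x : Fin n → ℝ, FutureCausal x → FutureCausal (φ x)) ↔
      (∀ T : MultilinearMap ℝ (fun _ : Fin r => (Fin n → ℝ)) ℝ,
        DPplus T → DPplus (T.compLinearMap (fun _ => φ.toLinearMap)))) := by
  refine ⟨⟨fun hφ s _ T hT => hT.compLinearMap hφ, fun h x hx => ?_⟩,
    ⟨fun hφ T hT => hT.compLinearMap hφ, fun h x hx => ?_⟩⟩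
  · exact futureCausal_map_of_dpplus_compLinearMap hodd φ (h r hr) hx
  · exact futureCausal_map_of_dpplus_compLinearMap hodd φ h hx

end PaperCausal
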